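/- (Free evolution implies true evolution, geometric case.) Fix q ∈ (0,1), integers N, k ≥ 1, a_n > 0 for every integer n ≥ 1, and jump parameters α_1, α_2, … ∈ (0,1). Suppose u : ℤ_{≥0} × ℤ^k → ℝ satisfies: (1) for all t ≥ 0 and all n⃗ ∈ ℤ^k with every coordinate ≥ 1, u(t+1;n⃗) = ([∇_{−a_{n_1} α_{t+1}}]_1 ⋯ [∇_{−a_{n_k} α_{t+1}}]_k u(t;·))(n⃗); (2) for all t ≥ 0, every i ∈ {1,…,k−1} and every n⃗ ∈ ℤ^k with n_i = n_{i+1}, ([∇]_i − q [∇]_{i+1}) u(t;n⃗) = 0; (3) u(t;n⃗) = 0 for all t whenever some coordinate of n⃗ is ≤ 0. Define h(t;y⃗) = u(t; n⃗(y⃗)) for y⃗ ∈ Y^N_k. Then for all t ≥ 0 and y⃗ ∈ Y^N_k: h(t+1;y⃗) = (A^{(−a_1 α_{t+1})}_1 ⋯ A^{(−a_N α_{t+1})}_N h(t;·))(y⃗) (the operator with index N applied first), and h(t;y⃗) = 0 whenever y_0 > 0. -/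

import Mathlib

/-- The q-Pochhammer symbol `(a;q)_n = ∏_{i=0}^{n-1} (1 - a q^i)`. -/
noncomputable def qPoch (q a : ℝ) (n : ℕ) : ℝ := ∏ i ∈ Finset.range n, (1 - a * q ^ i)

/-- The coefficients `C_a(y,s)`, with the convention `C_a(y,s) = 0` for `s < 0` or `s > y`. -/
noncomputable def Cco (q a : ℝ) (y : ℕ) (s : ℤ) : ℝ :=
  if 0 ≤ s ∧ s ≤ (y : ℤ) then
    (-a) ^ s.toNat * qPoch q (-a) (y - s.toNat) *
      (qPoch q q y / (qPoch q q (y - s.toNat) * qPoch q q s.toNat))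
  else 0

/-- `([∇]_i f)(n⃗) = f(n⃗ - e_i) - f(n⃗)`. -/
noncomputable def nablaD {k : ℕ} (i : Fin k) (f : (Fin k → ℤ) → ℝ) (n : Fin k → ℤ) : ℝ :=
  f (Function.update n i (n i - 1)) - f n

/-- `([∇_x]_i f)(n⃗) = (1+x) f(n⃗) - x f(n⃗ - e_i)`. -/
noncomputable def nablaX {k : ℕ} (x : ℝ) (i : Fin k) (f : (Fin k → ℤ) → ℝ)
    (n : Fin k → ℤ) : ℝ :=
  (1 + x) * f n - x * f (Function.update n i (n i - 1))

/-- `y⃗^{s}_{i,i-1}`: move `s` units of mass from coordinate `i+1` (paper index `i+1 ∈ {1,…,N}`)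
to coordinate `i` of `y⃗ ∈ Y^N = ℤ_{≥0}^{N+1}`. -/
def moveY {N : ℕ} (y : Fin (N + 1) → ℕ) (i : Fin N) (s : ℕ) : Fin (N + 1) → ℕ :=
  Function.update (Function.update y i.succ (y i.succ - s)) i.castSucc (y i.castSucc + s)

/-- The operator `(A^{(a)}_i f)(y⃗) = ∑_{s=0}^{y_i} C_a(y_i,s) f(y⃗^{s}_{i,i-1})`,
where `i : Fin N` denotes paper index `i+1`. -/
noncomputable def Aop {N : ℕ} (q a : ℝ) (i : Fin N) (f : (Fin (N + 1) → ℕ) → ℝ)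
    (y : Fin (N + 1) → ℕ) : ℝ :=
  ∑ s ∈ Finset.range (y i.succ + 1), Cco q a (y i.succ) (s : ℤ) * f (moveY y i s)

/-- The composition `A^{(c_1)}_1 ⋯ A^{(c_N)}_N f`, with the operator of index `N` applied first. -/
noncomputable def Acomp {N : ℕ} (q : ℝ) (c : Fin N → ℝ) (f : (Fin (N + 1) → ℕ) → ℝ) :
    (Fin (N + 1) → ℕ) → ℝ :=
  (List.finRange N).foldr (fun i g => Aop q (c i) i g) f

/-- `n⃗(y⃗) ∈ ℤ^k`: the weakly decreasing vector containing exactly `y_v` entries equal to `v`. -/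
def nvec (N k : ℕ) (y : Fin (N + 1) → ℕ) (j : Fin k) : ℕ :=
  (Finset.univ.filter
    (fun v : Fin (N + 1) => (j : ℕ) < ∑ i ∈ Finset.Ici v, y i)).sup (fun v => (v : ℕ))

/-- Lower the `i`-th coordinate of `n` by one. -/
def dec (i : ℕ) (n : ℕ → ℤ) : ℕ → ℤ := Function.update n i (n i - 1)

/-- Lower by one the coordinates of `n` with index in `[p, r)`. -/
def lowerOn (p r : ℕ) (n : ℕ → ℤ) : ℕ → ℤ := fun j => if p ≤ j ∧ j < r then n j - 1 else n j

/-- The analogue of `nablaX` for functions of infinitely many coordinates. -/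
noncomputable def nabX (x : ℝ) (i : ℕ) (f : (ℕ → ℤ) → ℝ) (n : ℕ → ℤ) : ℝ :=
  (1 + x) * f n - x * f (dec i n)

/-- The two-body boundary condition `[∇]_i f = q [∇]_{i+1} f` on the hyperplane `n_i = n_{i+1}`. -/
def BoundaryCond (q : ℝ) (i : ℕ) (f : (ℕ → ℤ) → ℝ) : Prop :=
  ∀ n : ℕ → ℤ, n i = n (i + 1) → f (dec i n) - f n = q * (f (dec (i + 1) n) - f n)

/-- The composition of the operators `nabX (c j) j` over the indices `j` in `l`. -/
noncomputable def nabComp (c : ℕ → ℝ) (l : List ℕ) (f : (ℕ → ℤ) → ℝ) : (ℕ → ℤ) → ℝ :=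
  l.foldr (fun j g => nabX (c j) j g) f

theorem dec_of_ne {i j : ℕ} (h : j ≠ i) (n : ℕ → ℤ) : dec i n j = n j :=
  Function.update_of_ne h _ _

theorem dec_comm (i j : ℕ) (n : ℕ → ℤ) : dec i (dec j n) = dec j (dec i n) := by
  rcases eq_or_ne i j with rfl | h
  · rfl
  · funext l
    simp only [dec, Function.update_apply]
    split_ifs <;> grind

theorem nabX_comm (x y : ℝ) (i j : ℕ) (f : (ℕ → ℤ) → ℝ) :
    nabX x i (nabX y j f) = nabX y j (nabX x i f) := by
  funext n
  simp only [nabX, dec_comm i j]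
  ring

theorem nabComp_append (c : ℕ → ℝ) (l₁ l₂ : List ℕ) (f : (ℕ → ℤ) → ℝ) :
    nabComp c (l₁ ++ l₂) f = nabComp c l₁ (nabComp c l₂ f) :=
  List.foldr_append

theorem nabComp_comm (c : ℕ → ℝ) (l₁ l₂ : List ℕ) (f : (ℕ → ℤ) → ℝ) :
    nabComp c l₁ (nabComp c l₂ f) = nabComp c l₂ (nabComp c l₁ f) := by
  rw [← nabComp_append, ← nabComp_append]
  exact List.perm_append_comm.foldr_eq' (f := fun j g => nabX (c j) j g)
    (fun i _ j _ g => nabX_comm _ _ _ _ g) f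

theorem nabComp_congr {c c' : ℕ → ℝ} {l : List ℕ} (h : ∀ j ∈ l, c j = c' j)
    (f : (ℕ → ℤ) → ℝ) : nabComp c l f = nabComp c' l f := by
  induction l with
  | nil => rfl
  | cons i l ih =>
    simp only [nabComp, List.foldr_cons] at ih ⊢
    rw [ih fun j hj => h j (List.mem_cons_of_mem _ hj), h i List.mem_cons_self]

theorem BoundaryCond.nabX {q : ℝ} {i : ℕ} {f : (ℕ → ℤ) → ℝ} (h : BoundaryCond q i f)
    (x : ℝ) {j : ℕ} (h1 : i ≠ j) (h2 : i + 1 ≠ j) : BoundaryCond q i (nabX x j f) := by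
  intro n hn
  have e := h n hn
  have e' := h (dec j n) (by rw [dec_of_ne h1, dec_of_ne h2, hn])
  simp only [_root_.nabX, dec_comm j]
  linear_combination (1 + x) * e - x * e'

theorem BoundaryCond.nabComp {q : ℝ} {i : ℕ} {f : (ℕ → ℤ) → ℝ} (h : BoundaryCond q i f)
    (c : ℕ → ℝ) {l : List ℕ} (hl : ∀ j ∈ l, i ≠ j ∧ i + 1 ≠ j) :
    BoundaryCond q i (nabComp c l f) := by
  induction l with
  | nil => exact h
  | cons j l ih =>
    exact (ih fun m hm => hl m (List.mem_cons_of_mem _ hm)).nabX _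
      (hl j List.mem_cons_self).1 (hl j List.mem_cons_self).2

theorem nabComp_eq_zero (c : ℕ → ℝ) (l : List ℕ) {f : (ℕ → ℤ) → ℝ} {i : ℕ}
    (hf : ∀ n : ℕ → ℤ, n i ≤ 0 → f n = 0) (n : ℕ → ℤ) (hn : n i ≤ 0) :
    nabComp c l f n = 0 := by
  induction l generalizing n with
  | nil => exact hf n hn
  | cons j l ih =>
    have hd : dec j n i ≤ 0 := by
      simp only [dec, Function.update_apply]
      split_ifs <;> grind
    have e1 := ih n hn
    have e2 := ih _ hd
    simp only [nabComp, List.foldr_cons, nabX] at e1 e2 ⊢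
    rw [e1, e2]
    ring

theorem foldr_nablaX_eq_nabComp {k : ℕ} (c : ℕ → ℝ) (l : List (Fin k)) (f : (Fin k → ℤ) → ℝ)
    (n : ℕ → ℤ) :
    (l.foldr (fun (i : Fin k) g => nablaX (c i) i g) f) (fun j => n j)
      = nabComp c (l.map Fin.val) (fun m => f (fun j => m j)) n := by
  induction l generalizing n with
  | nil => rfl
  | cons i l ih =>
    have hu : Function.update (fun j : Fin k => n j) i (n i - 1) = fun j : Fin k => dec i n j :=
      (Function.update_comp_eq_of_injective n Fin.val_injective i _).symm
    have e1 := ih n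
    have e2 := ih (dec i n)
    simp only [nabComp, List.map_cons, List.foldr_cons, nabX, nablaX] at e1 e2 ⊢
    rw [hu, e1, e2]

theorem dec_sub_eq_pow_mul {q : ℝ} {f : (ℕ → ℤ) → ℝ} {p : ℕ} (d : ℕ) (n : ℕ → ℤ) {m : ℤ}
    (hf : ∀ i, p ≤ i → i < p + d → BoundaryCond q i f)
    (hn : ∀ j, p ≤ j → j ≤ p + d → n j = m) :
    f (dec p n) - f n = q ^ d * (f (dec (p + d) n) - f n) := by
  induction d with
  | zero => simp
  | succ d ih =>
    rw [ih (fun i h1 h2 => hf i h1 (by omega)) (fun j h1 h2 => hn j h1 (by omega)),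
      hf (p + d) (by omega) (by omega) n
        ((hn _ (by omega) (by omega)).trans (hn _ (by omega) (by omega)).symm)]
    rw [pow_succ, add_assoc, mul_assoc]

theorem qPoch_succ (q a : ℝ) (n : ℕ) : qPoch q a (n + 1) = qPoch q a n * (1 - a * q ^ n) :=
  Finset.prod_range_succ _ _

theorem qPoch_self_ne_zero {q : ℝ} (hq : q ∈ Set.Ioo (0 : ℝ) 1) (n : ℕ) : qPoch q q n ≠ 0 := by
  refine Finset.prod_ne_zero_iff.mpr fun i _ => ?_
  have : q ^ (i + 1) < 1 := pow_lt_one₀ hq.1.le hq.2 (by omega)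
  rw [← pow_succ']
  linarith

theorem Cco_natCast (q a : ℝ) {y s : ℕ} (h : s ≤ y) :
    Cco q a y s = (-a) ^ s * qPoch q (-a) (y - s) *
      (qPoch q q y / (qPoch q q (y - s) * qPoch q q s)) := by
  simp [Cco, h]

theorem Cco_eq_zero (q a : ℝ) {y s : ℕ} (h : y < s) : Cco q a y s = 0 := by
  simp [Cco, h]

theorem Cco_succ_zero {q : ℝ} (hq : q ∈ Set.Ioo (0 : ℝ) 1) (a : ℝ) (y : ℕ) :
    Cco q a (y + 1) (0 : ℕ) = (1 + a * q ^ y) * Cco q a y (0 : ℕ) := by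
  have h1 := qPoch_self_ne_zero hq y
  have h2 := qPoch_self_ne_zero hq (y + 1)
  rw [Cco_natCast _ _ (Nat.zero_le _), Cco_natCast _ _ (Nat.zero_le _)]
  have h0 : qPoch q q 0 = 1 := rfl
  simp only [Nat.sub_zero, h0, mul_one, div_self h1, div_self h2, qPoch_succ q (-a), pow_zero]
  ring

theorem Cco_succ_succ {q : ℝ} (hq : q ∈ Set.Ioo (0 : ℝ) 1) (a : ℝ) {y s : ℕ} (h : s ≤ y) :
    Cco q a (y + 1) (s + 1 : ℕ)
      = (1 + a * q ^ (y - (s + 1))) * Cco q a y (s + 1 : ℕ) - a * q ^ (y - s) * Cco q a y s := by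
  obtain ⟨d, rfl⟩ := Nat.exists_eq_add_of_le h
  have h1 := qPoch_self_ne_zero hq (s + d)
  have h2 := qPoch_self_ne_zero hq s
  have hs : 1 - q * q ^ s ≠ 0 := by
    have := qPoch_self_ne_zero hq (s + 1)
    rw [qPoch_succ] at this
    exact right_ne_zero_of_mul this
  rcases d with _ | d
  · simp only [Nat.add_zero]
    rw [Cco_natCast _ _ le_rfl, Cco_eq_zero q a (Nat.lt_succ_self _), Cco_natCast _ _ le_rfl]
    have h0 (b : ℝ) : qPoch q b 0 = 1 := rfl
    simp only [Nat.sub_self, h0, one_mul, qPoch_succ]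
    field_simp
    ring
  · have h3 := qPoch_self_ne_zero hq d
    have hd : 1 - q * q ^ d ≠ 0 := by
      have := qPoch_self_ne_zero hq (d + 1)
      rw [qPoch_succ] at this
      exact right_ne_zero_of_mul this
    rw [Cco_natCast _ _ (by omega), Cco_natCast _ _ (by omega), Cco_natCast _ _ (by omega)]
    have e1 : s + (d + 1) + 1 - (s + 1) = d + 1 := by omega
    have e2 : s + (d + 1) - (s + 1) = d := by omega
    have e3 : s + (d + 1) - s = d + 1 := by omega
    simp only [e1, e2, e3, qPoch_succ q _ (s + (d + 1)), qPoch_succ q _ d, qPoch_succ q _ s,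
      pow_add, pow_one]
    generalize q ^ d = Q at hd ⊢
    generalize q ^ s = R at hs ⊢
    have hd' : 1 - Q * q ≠ 0 := mul_comm q Q ▸ hd
    have hs' : 1 - R * q ≠ 0 := mul_comm q R ▸ hs
    field_simp
    ring

theorem nabComp_cluster {q : ℝ} (hq : q ∈ Set.Ioo (0 : ℝ) 1) {c : ℕ → ℝ} {a : ℝ}
    {f : (ℕ → ℤ) → ℝ} {m : ℤ} (y p : ℕ) (n : ℕ → ℤ)
    (hc : ∀ j, p ≤ j → j < p + y → c j = a)
    (hf : ∀ i, p ≤ i → i + 1 < p + y → BoundaryCond q i f)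
    (hn : ∀ j, p ≤ j → j < p + y → n j = m) :
    nabComp c (List.range' p y) f n
      = ∑ s ∈ Finset.range (y + 1), Cco q a y s * f (lowerOn (p + y - s) (p + y) n) := by
  induction y generalizing p n with
  | zero =>
    have : lowerOn p p n = n := by
      funext j
      simp only [lowerOn]
      rw [if_neg (by omega)]
    simp [nabComp, this, Cco, qPoch]
  | succ y ih =>
    have e1 := ih (p + 1) n (fun j h1 h2 => hc j (by omega) (by omega))
      (fun i h1 h2 => hf i (by omega) (by omega)) (fun j h1 h2 => hn j (by omega) (by omega))
    have e2 := ih (p + 1) (dec p n) (fun j h1 h2 => hc j (by omega) (by omega))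
      (fun i h1 h2 => hf i (by omega) (by omega))
      (fun j h1 h2 => by rw [dec_of_ne (by omega)]; exact hn j (by omega) (by omega))
    have e0 : nabComp c (List.range' p (y + 1)) f n
        = (1 + a) * nabComp c (List.range' (p + 1) y) f n
          - a * nabComp c (List.range' (p + 1) y) f (dec p n) := by
      rw [← hc p le_rfl (by omega)]
      rfl
    have hp : p + 1 + y = p + (y + 1) := by omega
    rw [e0, e1, e2, hp]
    set F : ℕ → ℝ := fun s => f (lowerOn (p + (y + 1) - s) (p + (y + 1)) n) with hF
    have key : ∀ s ∈ Finset.range (y + 1),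
        f (lowerOn (p + (y + 1) - s) (p + (y + 1)) (dec p n))
          = F s + q ^ (y - s) * (F (s + 1) - F s) := by
      intro s hs
      have hs : s ≤ y := Nat.lt_succ_iff.mp (Finset.mem_range.mp hs)
      have hd : lowerOn (p + (y + 1) - s) (p + (y + 1)) (dec p n)
          = dec p (lowerOn (p + (y + 1) - s) (p + (y + 1)) n) := by
        funext j
        by_cases hj : j = p
        · subst hj
          simp only [lowerOn, dec, Function.update_self]
          rw [if_neg (by omega), if_neg (by omega)]
        · simp only [lowerOn, dec_of_ne hj]
      have hd' : dec (p + (y - s)) (lowerOn (p + (y + 1) - s) (p + (y + 1)) n)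
          = lowerOn (p + (y + 1) - (s + 1)) (p + (y + 1)) n := by
        funext j
        by_cases hj : j = p + (y - s)
        · subst hj
          simp only [lowerOn, dec, Function.update_self]
          rw [if_neg (by omega), if_pos (by omega)]
        · rw [dec_of_ne hj]
          simp only [lowerOn]
          congr 1
          apply propext
          omega
      have := dec_sub_eq_pow_mul (q := q) (f := f) (p := p) (y - s)
        (lowerOn (p + (y + 1) - s) (p + (y + 1)) n) (m := m)
        (fun i h1 h2 => hf i h1 (by omega))
        (fun j h1 h2 => by
          simp only [lowerOn]
          rw [if_neg (by omega)]
          exact hn j h1 (by omega))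
      rw [hd'] at this
      rw [hd]
      simp only [hF]
      linarith
    rw [Finset.sum_congr rfl fun (s : ℕ) hs => congrArg (Cco q a y s * ·) (key s hs), Finset.mul_sum, Finset.mul_sum,
      ← Finset.sum_sub_distrib]
    have hR : ∑ s ∈ Finset.range (y + 1 + 1), Cco q a (y + 1) s * F s
        = ∑ s ∈ Finset.range (y + 1), (1 + a * q ^ (y - s)) * Cco q a y s * F s
          - ∑ s ∈ Finset.range (y + 1), a * q ^ (y - s) * Cco q a y s * F (s + 1) := by
      have hx : ∑ s ∈ Finset.range (y + 1), (1 + a * q ^ (y - s)) * Cco q a y s * F s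
          = ∑ s ∈ Finset.range (y + 1 + 1), (1 + a * q ^ (y - s)) * Cco q a y s * F s := by
        rw [Finset.sum_range_succ _ (y + 1), Cco_eq_zero q a (Nat.lt_succ_self y)]
        ring
      rw [hx, Finset.sum_range_succ', Finset.sum_range_succ' _ (y + 1), Cco_succ_zero hq,
        Finset.sum_congr rfl fun s hs => by
          rw [Cco_succ_succ hq a (Nat.lt_succ_iff.mp (Finset.mem_range.mp hs)), sub_mul],
        Finset.sum_sub_distrib, Nat.sub_zero]
      ring
    rw [hR, ← Finset.sum_sub_distrib]
    refine Finset.sum_congr rfl fun s _ => ?_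
    ring

/-- The number `∑_{v ≥ w} y_v` of particles at sites `≥ w`. -/
def tailSum {N : ℕ} (y : Fin (N + 1) → ℕ) (w : ℕ) : ℕ :=
  ∑ v with w ≤ (v : Fin (N + 1)).val, y v

/-- The vector `nvec` continued by zeros to all of `ℕ`. -/
def posVec {N : ℕ} (y : Fin (N + 1) → ℕ) (j : ℕ) : ℕ :=
  (Finset.univ.filter
    (fun v : Fin (N + 1) => j < ∑ i ∈ Finset.Ici v, y i)).sup (fun v => (v : ℕ))

theorem tailSum_zero {N : ℕ} (y : Fin (N + 1) → ℕ) : tailSum y 0 = ∑ v, y v := by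
  simp [tailSum]

theorem tailSum_of_lt {N : ℕ} (y : Fin (N + 1) → ℕ) {w : ℕ} (h : N < w) : tailSum y w = 0 := by
  refine Finset.sum_eq_zero fun v hv => ?_
  have := (Finset.mem_filter.mp hv).2
  omega

theorem tailSum_anti {N : ℕ} (y : Fin (N + 1) → ℕ) : Antitone (tailSum y) := fun v w h =>
  Finset.sum_le_sum_of_subset fun i hi => by
    simp only [Finset.mem_filter, Finset.mem_univ, true_and] at hi ⊢
    omega

theorem tailSum_eq_add {N : ℕ} (y : Fin (N + 1) → ℕ) (v : Fin (N + 1)) :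
    tailSum y v = y v + tailSum y (v + 1) := by
  have : (Finset.univ.filter fun i : Fin (N + 1) => (v : ℕ) ≤ i)
      = insert v (Finset.univ.filter fun i : Fin (N + 1) => (v : ℕ) + 1 ≤ i) := by
    ext i
    simp only [Finset.mem_filter, Finset.mem_univ, true_and, Finset.mem_insert, Fin.ext_iff]
    omega
  rw [tailSum, this, Finset.sum_insert (by simp)]
  rfl

theorem le_posVec_iff {N : ℕ} (y : Fin (N + 1) → ℕ) (w j : ℕ) :
    w ≤ posVec y j ↔ w = 0 ∨ j < tailSum y w := by
  rcases Nat.eq_zero_or_pos w with rfl | hw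
  · simp
  have hI (v : Fin (N + 1)) : ∑ i ∈ Finset.Ici v, y i = tailSum y v := by
    refine Finset.sum_congr ?_ fun _ _ => rfl
    ext i
    simp only [Finset.mem_Ici, Finset.mem_filter, Finset.mem_univ, true_and, Fin.le_def]
  simp only [posVec, hI, Finset.le_sup_iff (show ⊥ < w from hw), Finset.mem_filter,
    Finset.mem_univ, true_and, hw.ne', false_or]
  constructor
  · rintro ⟨v, h1, h2⟩
    exact h1.trans_le (tailSum_anti y h2)
  · intro h
    have : w < N + 1 := by
      by_contra hN
      rw [tailSum_of_lt y (by omega)] at h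
      omega
    exact ⟨⟨w, this⟩, h, le_rfl⟩

theorem posVec_eq {N : ℕ} (y : Fin (N + 1) → ℕ) {w j : ℕ} (h1 : tailSum y (w + 1) ≤ j)
    (h2 : j < tailSum y w) : posVec y j = w := by
  have e1 := le_posVec_iff y w j
  have e2 := le_posVec_iff y (w + 1) j
  omega

theorem tailSum_moveY {N : ℕ} (y : Fin (N + 1) → ℕ) (i : Fin N) {s : ℕ} (hs : s ≤ y i.succ)
    (w : ℕ) : tailSum (moveY y i s) w = if w = i + 1 then tailSum y w - s else tailSum y w := by
  have hpt (v : Fin (N + 1)) : moveY y i s v + (if v = i.succ then s else 0)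
      = y v + (if v = i.castSucc then s else 0) := by
    have hne : i.succ ≠ i.castSucc := by simp [Fin.ext_iff]
    by_cases h1 : v = i.castSucc
    · subst h1
      simp [moveY, hne.symm]
    · by_cases h2 : v = i.succ
      · subst h2
        simp [moveY, hne, hs]
      · simp [moveY, h1, h2]
  have hsum : tailSum (moveY y i s) w + (if w ≤ i + 1 then s else 0)
      = tailSum y w + (if w ≤ i then s else 0) := by
    have := Finset.sum_congr (rfl : (Finset.univ.filter fun v : Fin (N + 1) => w ≤ v.val) = _)
      fun v _ => hpt v
    rw [Finset.sum_add_distrib, Finset.sum_add_distrib, Finset.sum_ite_eq', Finset.sum_ite_eq']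
      at this
    simpa [tailSum] using this
  split_ifs at hsum ⊢ <;> omega

theorem posVec_moveY {N : ℕ} (y : Fin (N + 1) → ℕ) (i : Fin N) {s : ℕ} (hs : s ≤ y i.succ) :
    (fun j => (posVec (moveY y i s) j : ℤ))
      = lowerOn (tailSum y (i + 1) - s) (tailSum y (i + 1)) (fun j => (posVec y j : ℤ)) := by
  funext j
  have h1 : tailSum y (i + 1) = y i.succ + tailSum y (i + 1 + 1) := tailSum_eq_add y i.succ
  simp only [lowerOn]
  split_ifs with h
  · have e : posVec y j = i + 1 := posVec_eq y (by omega) h.2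
    have e' : posVec (moveY y i s) j = i := by
      apply posVec_eq <;> rw [tailSum_moveY y i hs]
      · rw [if_pos rfl]
        exact h.1
      · rw [if_neg (by omega)]
        exact h.2.trans_le (tailSum_anti y (Nat.le_succ _))
    rw [e, e']
    push_cast
    ring
  · congr 1
    refine eq_of_forall_le_iff fun w => ?_
    rw [le_posVec_iff, le_posVec_iff, tailSum_moveY y i hs]
    split_ifs with hw
    · subst hw
      omega
    · rfl

theorem foldr_Aop_eq_nabComp {q : ℝ} (hq : q ∈ Set.Ioo (0 : ℝ) 1) {N k : ℕ} (c : ℕ → ℝ)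
    {f : (ℕ → ℤ) → ℝ} (hf : ∀ i, i + 1 < k → BoundaryCond q i f) (d : ℕ) {w : ℕ}
    (hw : w + d = N) (y : Fin (N + 1) → ℕ) (hy : tailSum y 0 = k) :
    (((List.finRange N).drop w).foldr (fun (i : Fin N) g => Aop q (c (i + 1)) i g)
        (fun y' => f (fun j => (posVec y' j : ℤ)))) y
      = nabComp (fun j => c (posVec y j)) (List.range (tailSum y (w + 1))) f
          (fun j => (posVec y j : ℤ)) := by
  induction d generalizing w y with
  | zero =>
    rw [List.drop_eq_nil_of_le (by simp; omega), tailSum_of_lt y (by omega)]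
    rfl
  | succ d ih =>
    have hwN : w < N := by omega
    set i : Fin N := ⟨w, hwN⟩ with hi
    have hdrop : (List.finRange N).drop w = i :: (List.finRange N).drop (w + 1) := by
      rw [List.drop_eq_getElem_cons (by simpa using hwN)]
      simp [hi]
    have hS : tailSum y (w + 1) = tailSum y (w + 1 + 1) + y i.succ := by
      rw [add_comm _ (y i.succ)]
      exact tailSum_eq_add y i.succ
    have hk : tailSum y (w + 1) ≤ k := hy ▸ tailSum_anti y (Nat.zero_le _)
    have hrange : List.range (tailSum y (w + 1))
        = List.range (tailSum y (w + 1 + 1)) ++ List.range' (tailSum y (w + 1 + 1)) (y i.succ) := by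
      rw [hS, List.range_eq_range', List.range_eq_range', ← List.range'_append_1, Nat.zero_add]
    rw [hdrop, List.foldr_cons, hrange, nabComp_append, nabComp_comm,
      nabComp_cluster hq (a := c (w + 1)) (m := ((w + 1 : ℕ) : ℤ))]
    · refine Finset.sum_congr rfl fun s hs => ?_
      have hs : s ≤ y i.succ := Nat.lt_succ_iff.mp (Finset.mem_range.mp hs)
      have hpv := posVec_moveY y i hs
      congr 1
      rw [ih (by omega) (moveY y i s) (by rw [tailSum_moveY y i hs, if_neg (by omega), hy]),
        hpv, tailSum_moveY y i hs, if_neg (by simp [hi]), ← hS]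
      refine congrFun (nabComp_congr (fun j hj => ?_) f) _
      have := congrFun hpv j
      have hj := List.mem_range.mp hj
      simp only [lowerOn] at this
      rw [if_neg (by simp only [hi]; omega)] at this
      exact congrArg c (by exact_mod_cast this)
    · intro j h1 h2
      exact congrArg c (posVec_eq y h1 (by omega))
    · intro j h1 h2
      refine (hf j (by omega)).nabComp _ fun l hl => ?_
      have := List.mem_range.mp hl
      omega
    · intro j h1 h2
      exact congrArg _ (posVec_eq y h1 (by omega))

theorem stmt_10 (q : ℝ) (hq : q ∈ Set.Ioo (0:ℝ) 1) (N k : ℕ) (hN : 1 ≤ N) (hk : 1 ≤ k)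
    (a : ℤ → ℝ) (ha : ∀ n : ℤ, 1 ≤ n → 0 < a n)
    (α : ℕ → ℝ) (hα : ∀ s : ℕ, 1 ≤ s → α s ∈ Set.Ioo (0:ℝ) 1)
    (u : ℕ → (Fin k → ℤ) → ℝ)
    (h1 : ∀ t : ℕ, ∀ n : Fin k → ℤ, (∀ i, 1 ≤ n i) →
      u (t + 1) n
        = ((List.finRange k).foldr (fun i g => nablaX (-(a (n i) * α (t + 1))) i g) (u t)) n)
    (h2 : ∀ t : ℕ, ∀ (i : ℕ) (hi : i + 1 < k) (n : Fin k → ℤ),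
      n ⟨i, by omega⟩ = n ⟨i + 1, hi⟩ →
      nablaD ⟨i, by omega⟩ (u t) n - q * nablaD ⟨i + 1, hi⟩ (u t) n = 0)
    (h3 : ∀ t : ℕ, ∀ n : Fin k → ℤ, (∃ i, n i ≤ 0) → u t n = 0) :
    ∀ t : ℕ, ∀ y : Fin (N + 1) → ℕ, (∑ v, y v) = k →
      (u (t + 1) (fun j => (nvec N k y j : ℤ))
        = Acomp q (fun i => -(a ((i : ℕ) + 1) * α (t + 1)))
            (fun y' => u t (fun j => (nvec N k y' j : ℤ))) y)
      ∧ (0 < y 0 → u t (fun j => (nvec N k y j : ℤ)) = 0) := by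
  intro t y hy
  have hS0 : tailSum y 0 = k := (tailSum_zero y).trans hy
  have hS1 : tailSum y 0 = y 0 + tailSum y (0 + 1) := tailSum_eq_add y 0
  have hzero : ∀ t', 0 < y 0 → u t' (fun j => (nvec N k y j : ℤ)) = 0 := by
    intro t' h0
    refine h3 t' _ ⟨⟨k - 1, by omega⟩, ?_⟩
    have : posVec y (k - 1) = 0 := posVec_eq y (by omega) (by omega)
    exact le_of_eq (congrArg Nat.cast this)
  refine ⟨?_, hzero t⟩
  set f : (ℕ → ℤ) → ℝ := fun n => u t (fun j : Fin k => n j) with hf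
  set c : ℕ → ℝ := fun v => -(a v * α (t + 1)) with hc
  have hbc : ∀ i, i + 1 < k → BoundaryCond q i f := by
    intro i hi n hn
    have hu (l : ℕ) (hl : l < k) :
        Function.update (fun j : Fin k => n j) ⟨l, hl⟩ (n l - 1) = fun j : Fin k => dec l n j :=
      (Function.update_comp_eq_of_injective n Fin.val_injective ⟨l, hl⟩ _).symm
    have := h2 t i hi (fun j => n j) hn
    simp only [nablaD, hu] at this
    exact sub_eq_zero.mp this
  have hA : Acomp q (fun i => -(a ((i : ℕ) + 1) * α (t + 1)))
      (fun y' => u t (fun j => (nvec N k y' j : ℤ))) y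
        = nabComp (fun j => c (posVec y j)) (List.range (tailSum y (0 + 1))) f
          (fun j => (posVec y j : ℤ)) := by
    rw [← foldr_Aop_eq_nabComp hq c hbc N (Nat.zero_add N) y hS0]
    simp only [hc, Nat.cast_add, Nat.cast_one]
    rfl
  rw [hA]
  rcases Nat.eq_zero_or_pos (y 0) with h0 | h0
  · rw [h1 t _ fun j => ?_]
    · refine (foldr_nablaX_eq_nabComp (fun j => c (posVec y j)) (List.finRange k) (u t)
        (fun j => (posVec y j : ℤ))).trans ?_
      rw [show tailSum y (0 + 1) = k by omega, List.map_coe_finRange_eq_range]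
    · have : 1 ≤ posVec y j := (le_posVec_iff y 1 j).mpr (Or.inr (by
        have := j.isLt
        rw [Nat.zero_add] at hS1
        omega))
      exact_mod_cast this
  · rw [hzero _ h0, nabComp_eq_zero (i := k - 1)]
    · exact fun n hn => h3 t _ ⟨⟨k - 1, by omega⟩, hn⟩
    · have : posVec y (k - 1) = 0 := posVec_eq y (by omega) (by omega)
      exact le_of_eq (congrArg Nat.cast this)
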